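/- arXiv:2005.12243 — 2 statements merged into one kernel-verified Lean document; each statement's English description precedes it below -/
import Mathlib

section
/- There exists an absolute constant C ≥ 1 such that for every integer d ≥ 2 and every integer n with 2 d ln d ≤ n ≤ e^d · d · ln d, one has disp̃*(n, d) ≤ C · d · ln d / n. -/
open MeasureTheory Set

noncomputable section

/-- The unit cube `Q_d = [0,1]^d`. -/
def cube (d : ℕ) : Set (Fin d → ℝ) := Set.univ.pi fun _ => Set.Icc (0 : ℝ) 1

/-- The periodic interval `I(s,t)`: `(s,t)` if `s < t`, and `[0,1] \ [t,s]` if `t < s`. -/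
def perInterval (s t : ℝ) : Set ℝ :=
  if s < t then Set.Ioo s t else Set.Icc 0 1 \ Set.Icc t s

/-- `B` is a periodic axis-parallel box in the unit cube. -/
def IsPerBox {d : ℕ} (B : Set (Fin d → ℝ)) : Prop :=
  ∃ a b : Fin d → ℝ, a ∈ cube d ∧ b ∈ cube d ∧ (∀ i, a i ≠ b i) ∧
    B = Set.univ.pi fun i => perInterval (a i) (b i)

/-- Periodic dispersion of a point set `P ⊆ Q_d`. -/
def pdisp {d : ℕ} (P : Set (Fin d → ℝ)) : ℝ :=
  sSup {v : ℝ | ∃ B : Set (Fin d → ℝ), IsPerBox B ∧ B ∩ P = ∅ ∧ v = (volume B).toReal}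

/-- Minimal periodic dispersion `disp̃*(n,d)`. -/
def pminDisp (n d : ℕ) : ℝ :=
  sInf {v : ℝ | ∃ P : Finset (Fin d → ℝ),
    ↑P ⊆ cube d ∧ P.card = n ∧ v = pdisp (↑P : Set (Fin d → ℝ))}


lemma perInterval_subset_Icc {s t : ℝ} (hs : s ∈ Icc (0:ℝ) 1) (ht : t ∈ Icc (0:ℝ) 1) :
    perInterval s t ⊆ Icc 0 1 := by
  unfold perInterval
  split_ifs
  · exact fun x hx => ⟨hs.1.trans hx.1.le, hx.2.le.trans ht.2⟩
  · exact diff_subset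

lemma perInterval_measurable (s t : ℝ) : MeasurableSet (perInterval s t) := by
  unfold perInterval
  split_ifs
  · exact measurableSet_Ioo
  · exact measurableSet_Icc.diff measurableSet_Icc

lemma perInterval_vol_lt {s t : ℝ} (h : s < t) : (volume (perInterval s t)).toReal = t - s := by
  unfold perInterval
  rw [if_pos h, Real.volume_Ioo, ENNReal.toReal_ofReal (by linarith)]

lemma perInterval_vol_gt {s t : ℝ} (h : t < s) (ht : 0 ≤ t) (hs : s ≤ 1) :
    (volume (perInterval s t)).toReal = 1 - (s - t) := by
  unfold perInterval
  rw [if_neg (not_lt.2 h.le), measure_diff (Icc_subset_Icc ht hs) measurableSet_Icc.nullMeasurableSet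
    (by simp), Real.volume_Icc, Real.volume_Icc, ← ENNReal.ofReal_sub _ (by linarith),
    ENNReal.toReal_ofReal (by linarith)]
  ring

lemma inner_interval {a b : ℝ} (ha : a ∈ Icc (0:ℝ) 1) (hb : b ∈ Icc (0:ℝ) 1) (hab : a ≠ b)
    (m : ℕ) (hm : 0 < m) (hl : 2 / (m:ℝ) < (volume (perInterval a b)).toReal) :
    ∃ p q : ℕ, p ≤ m ∧ q ≤ m ∧ perInterval (p / m) (q / m) ⊆ perInterval a b ∧
      (volume (perInterval a b)).toReal - 2 / m ≤ (volume (perInterval (p / m) (q / m))).toReal := by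
  have hm' : (0:ℝ) < m := by exact_mod_cast hm
  have ham : 0 ≤ a * m := mul_nonneg ha.1 hm'.le
  have hbm : 0 ≤ b * m := mul_nonneg hb.1 hm'.le
  have hp : ⌈a * m⌉₊ ≤ m := by
    rw [Nat.ceil_le]; nlinarith [ha.2]
  have hq : ⌊b * m⌋₊ ≤ m := by
    rw [← Nat.cast_le (α := ℝ)]
    refine (Nat.floor_le hbm).trans ?_
    nlinarith [hb.2]
  have p1 : a ≤ (⌈a * m⌉₊ : ℝ) / m := by
    rw [le_div_iff₀ hm']; exact Nat.le_ceil _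
  have p2 : (⌈a * m⌉₊ : ℝ) / m ≤ a + 1 / m := by
    rw [div_le_iff₀ hm', add_mul, one_div_mul_cancel hm'.ne']; exact (Nat.ceil_lt_add_one ham).le
  have q1 : (⌊b * m⌋₊ : ℝ) / m ≤ b := by
    rw [div_le_iff₀ hm']; exact Nat.floor_le hbm
  have q2 : b - 1 / m ≤ (⌊b * m⌋₊ : ℝ) / m := by
    rw [le_div_iff₀ hm', sub_mul, one_div_mul_cancel hm'.ne']; exact (Nat.sub_one_lt_floor _).le
  have p3 : (⌈a * m⌉₊ : ℝ) / m ≤ 1 := by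
    rw [div_le_one hm']; exact_mod_cast hp
  have q3 : 0 ≤ (⌊b * m⌋₊ : ℝ) / m := by positivity
  refine ⟨⌈a * m⌉₊, ⌊b * m⌋₊, hp, hq, ?_⟩
  generalize (⌈a * m⌉₊ : ℝ) / m = p at *
  generalize (⌊b * m⌋₊ : ℝ) / m = q at *
  have e : 2 / (m:ℝ) = 1 / m + 1 / m := by ring
  rcases lt_or_gt_of_ne hab with h | h
  · rw [perInterval_vol_lt h] at hl ⊢
    have hpq : p < q := by linarith
    rw [perInterval_vol_lt hpq]
    refine ⟨?_, by linarith⟩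
    unfold perInterval
    rw [if_pos h, if_pos hpq]
    exact Ioo_subset_Ioo p1 q1
  · rw [perInterval_vol_gt h hb.1 ha.2] at hl ⊢
    have hpq : q < p := by linarith
    rw [perInterval_vol_gt hpq q3 p3]
    refine ⟨?_, by linarith⟩
    unfold perInterval
    rw [if_neg (not_lt.2 h.le), if_neg (not_lt.2 hpq.le)]
    exact diff_subset_diff_right (Icc_subset_Icc q1 p1)

lemma cube_vol (d : ℕ) : volume (cube d) = 1 := by
  unfold cube
  rw [volume_pi_pi]; simp

lemma cube_meas (d : ℕ) : MeasurableSet (cube d) :=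
  MeasurableSet.univ_pi fun _ => measurableSet_Icc

open Classical in
lemma average_pt {ι : Type*} {d : ℕ} (F : Finset ι) (S : ι → Set (Fin d → ℝ)) (δ : ℝ)
    (hS : ∀ i ∈ F, MeasurableSet (S i)) (hc : ∀ i ∈ F, S i ⊆ cube d)
    (hv : ∀ i ∈ F, δ ≤ (volume (S i)).toReal) :
    ∃ x ∈ cube d, δ * F.card ≤ ((F.filter fun i => x ∈ S i).card : ℝ) := by
  have hint : ∀ i ∈ F, IntegrableOn ((S i).indicator fun _ => (1:ℝ)) (cube d) volume := by
    intro i hi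
    refine IntegrableOn.indicator ?_ (hS i hi)
    exact integrableOn_const (by rw [cube_vol]; simp)
  obtain ⟨x, hx, h⟩ := exists_setAverage_le (μ := volume) (s := cube d)
    (f := fun x => ∑ i ∈ F, (S i).indicator (fun _ => (1:ℝ)) x)
    (by rw [cube_vol]; simp) (by rw [cube_vol]; simp) (integrable_finset_sum _ hint)
  refine ⟨x, hx, ?_⟩
  rw [setAverage_eq, Measure.real, cube_vol, integral_finset_sum _ hint] at h
  have e : ∀ i ∈ F, δ ≤ ∫ x in cube d, (S i).indicator (fun _ => (1:ℝ)) x := by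
    intro i hi
    rw [setIntegral_indicator (hS i hi), inter_eq_right.2 (hc i hi)]
    simpa [Measure.real] using hv i hi
  have e2 := Finset.card_nsmul_le_sum F _ δ e
  have e3 : ∑ i ∈ F, (S i).indicator (fun _ => (1:ℝ)) x = ((F.filter fun i => x ∈ S i).card : ℝ) := by
    simp [indicator_apply, Finset.sum_ite]
  rw [e3] at h
  simp at h e2
  linarith

open Classical in
lemma greedy {ι : Type*} {d : ℕ} (F : Finset ι) (S : ι → Set (Fin d → ℝ)) (δ : ℝ) (hδ : δ ≤ 1)
    (hS : ∀ i ∈ F, MeasurableSet (S i)) (hc : ∀ i ∈ F, S i ⊆ cube d)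
    (hv : ∀ i ∈ F, δ ≤ (volume (S i)).toReal) (n : ℕ) :
    ∃ P : Finset (Fin d → ℝ), ↑P ⊆ cube d ∧ P.card ≤ n ∧
      ((F.filter fun i => ∀ x ∈ P, x ∉ S i).card : ℝ) ≤ (1 - δ) ^ n * F.card := by
  induction n with
  | zero => exact ⟨∅, by simp, by simp, by simp⟩
  | succ n ih =>
    obtain ⟨P, hP, hPn, hPc⟩ := ih
    set G := F.filter fun i => ∀ x ∈ P, x ∉ S i with hG
    have hGF : G ⊆ F := Finset.filter_subset _ _
    obtain ⟨x, hx, h⟩ := average_pt G S δ (fun i hi => hS i (hGF hi)) (fun i hi => hc i (hGF hi))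
      (fun i hi => hv i (hGF hi))
    refine ⟨insert x P, ?_, (Finset.card_insert_le _ _).trans (by omega), ?_⟩
    · rw [Finset.coe_insert]; exact insert_subset hx hP
    · have e : (F.filter fun i => ∀ y ∈ insert x P, y ∉ S i) = G.filter fun i => ¬ x ∈ S i := by
        ext i; simp [hG]; tauto
      rw [e]
      have := Finset.card_filter_add_card_filter_not (s := G) (fun i => x ∈ S i)
      have h2 : ((G.filter fun i => x ∈ S i).card : ℝ) + ((G.filter fun i => ¬ x ∈ S i).card : ℝ)
        = G.card := by exact_mod_cast this
      calc _ ≤ (1 - δ) * (G.card : ℝ) := by linarith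
        _ ≤ (1 - δ) * ((1 - δ) ^ n * F.card) := mul_le_mul_of_nonneg_left hPc (by linarith)
        _ = _ := by ring

abbrev Idx := Σ _ : ℕ, ℕ × ℕ

def T (N : ℕ) : Finset Idx :=
  (Finset.Icc 1 N).sigma fun m => Finset.range (m + 1) ×ˢ Finset.range (m + 1)

lemma T_sum (N : ℕ) : ∑ t ∈ T N, ((t.1 : ℝ) ^ 4)⁻¹ ≤ 8 := by
  unfold T
  rw [Finset.sum_sigma]
  have h1 : ∀ m ∈ Finset.Icc 1 N, ∑ t ∈ Finset.range (m + 1) ×ˢ Finset.range (m + 1),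
      ((m : ℝ) ^ 4)⁻¹ ≤ 4 * ((m:ℝ)^2)⁻¹ := by
    intro m hm
    have hm1 : (1:ℝ) ≤ m := by exact_mod_cast (Finset.mem_Icc.1 hm).1
    simp only [Finset.sum_const, Finset.card_product, Finset.card_range, nsmul_eq_mul]
    push_cast
    rw [← div_eq_mul_inv, ← div_eq_mul_inv, div_le_div_iff₀ (by positivity) (by positivity)]
    have : ((m:ℝ)+1)*(m+1) ≤ 4 * m^2 := by nlinarith
    calc _ ≤ (4 * (m:ℝ)^2) * m^2 := mul_le_mul_of_nonneg_right this (by positivity)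
      _ = _ := by ring
  refine (Finset.sum_le_sum h1).trans ?_
  rw [← Finset.mul_sum]
  have h2 : ∀ N : ℕ, ∑ m ∈ Finset.Icc 1 (N + 1), ((m:ℝ)^2)⁻¹ ≤ 2 - 1 / (N + 1) := by
    intro N
    induction N with
    | zero => norm_num
    | succ k ih =>
      rw [Finset.sum_Icc_succ_top (by omega)]
      have : (((k + 1 + 1 : ℕ):ℝ)^2)⁻¹ ≤ 1 / ((k:ℝ)+1) - 1 / (((k + 1 : ℕ):ℝ)+1) := by
        push_cast
        rw [div_sub_div _ _ (by positivity) (by positivity), ← one_div,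
          div_le_div_iff₀ (by positivity) (by positivity)]
        nlinarith [(Nat.cast_nonneg k : (0:ℝ) ≤ k)]
      linarith
  have h4 : ∑ m ∈ Finset.Icc 1 N, ((m:ℝ)^2)⁻¹ ≤ ∑ m ∈ Finset.Icc 1 (N + 1), ((m:ℝ)^2)⁻¹ :=
    Finset.sum_le_sum_of_subset_of_nonneg (Finset.Icc_subset_Icc le_rfl (by omega))
      fun _ _ _ => by positivity
  have h3 := h2 N
  have : (0:ℝ) ≤ 1 / (N + 1) := by positivity
  linarith

open Classical in
lemma count (d N : ℕ) (M : ℝ) (hM : 0 ≤ M) :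
    (((Fintype.piFinset fun _ : Fin d => T N).filter
      fun f => ∏ i, ((f i).1 : ℝ) ≤ M).card : ℝ) ≤ M ^ 4 * 8 ^ d := by
  rw [Finset.card_filter]
  push_cast
  calc _ ≤ ∑ f ∈ Fintype.piFinset fun _ : Fin d => T N, M ^ 4 * ∏ i, (((f i).1 : ℝ) ^ 4)⁻¹ := by
        refine Finset.sum_le_sum fun f hf => ?_
        split_ifs with h
        · have hpos : 0 < ∏ i, ((f i).1 : ℝ) := by
            refine Finset.prod_pos fun i _ => ?_
            have := Fintype.mem_piFinset.1 hf i
            simp only [T, Finset.mem_sigma, Finset.mem_Icc] at this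
            exact_mod_cast this.1.1
          rw [Finset.prod_inv_distrib, Finset.prod_pow, ← div_eq_mul_inv, le_div_iff₀ (by positivity), one_mul]
          exact pow_le_pow_left₀ hpos.le h 4
        · positivity
    _ = M ^ 4 * (∑ t ∈ T N, ((t.1 : ℝ) ^ 4)⁻¹) ^ d := by
        rw [← Finset.mul_sum, Finset.sum_prod_piFinset (T N) (fun _ t => ((t.1 : ℝ) ^ 4)⁻¹)]
        simp
    _ ≤ _ := by
        gcongr
        exact T_sum N

def bx {d : ℕ} (f : Fin d → Idx) : Set (Fin d → ℝ) :=
  Set.univ.pi fun i => perInterval (((f i).2.1 : ℝ) / (f i).1) (((f i).2.2 : ℝ) / (f i).1)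

lemma vol_pi {d : ℕ} (s : Fin d → Set ℝ) :
    (volume (Set.univ.pi s)).toReal = ∏ i, (volume (s i)).toReal := by
  rw [volume_pi_pi, ENNReal.toReal_prod]

lemma vol_le_one {s t : ℝ} (hs : s ∈ Icc (0:ℝ) 1) (ht : t ∈ Icc (0:ℝ) 1) :
    (volume (perInterval s t)).toReal ≤ 1 := by
  have := measure_mono (μ := volume) (perInterval_subset_Icc hs ht)
  rw [Real.volume_Icc] at this
  simpa using ENNReal.toReal_mono (by simp) this

lemma inner_box {d : ℕ} (hd : 1 ≤ d) {B : Set (Fin d → ℝ)} (hB : IsPerBox B) {ε : ℝ} (hε : 0 < ε)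
    (hv : ε < (volume B).toReal) :
    ∃ f : Fin d → Idx, f ∈ (Fintype.piFinset fun _ : Fin d => T ⌊(5 * d) ^ d / ε⌋₊) ∧
      ∏ i, ((f i).1 : ℝ) ≤ (5 * d) ^ d / ε ∧ bx f ⊆ B ∧ ε / 2 ≤ (volume (bx f)).toReal := by
  obtain ⟨a, b, ha, hb, hab, rfl⟩ := hB
  rw [vol_pi] at hv
  have ha' : ∀ i, a i ∈ Icc (0:ℝ) 1 := fun i => ha i (mem_univ i)
  have hb' : ∀ i, b i ∈ Icc (0:ℝ) 1 := fun i => hb i (mem_univ i)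
  set l : Fin d → ℝ := fun i => (volume (perInterval (a i) (b i))).toReal with hl
  have hl1 : ∀ i, l i ≤ 1 := fun i => vol_le_one (ha' i) (hb' i)
  have hl0 : ∀ i, 0 < l i := by
    intro i
    refine lt_of_le_of_ne ENNReal.toReal_nonneg fun h => ?_
    rw [Finset.prod_eq_zero (Finset.mem_univ i) h.symm] at hv
    linarith
  have hd' : (1:ℝ) ≤ d := by exact_mod_cast hd
  set m : Fin d → ℕ := fun i => ⌈4 * d / l i⌉₊ with hm
  have hm1 : ∀ i, 4 * d / l i ≤ m i := fun i => Nat.le_ceil _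
  have hm2 : ∀ i, (m i : ℝ) ≤ 5 * d / l i := by
    intro i
    have h1 := (Nat.ceil_lt_add_one (a := 4 * d / l i) (by have := hl0 i; positivity)).le
    have h2 : 1 ≤ d / l i := by
      rw [le_div_iff₀ (hl0 i)]; linarith [hl1 i]
    calc (m i : ℝ) ≤ 4 * d / l i + 1 := h1
      _ ≤ 4 * d / l i + d / l i := by linarith
      _ = _ := by ring
  have hm0 : ∀ i, 0 < m i := fun i => Nat.ceil_pos.2 (by have := hl0 i; positivity)
  have hm3 : ∀ i, 2 / (m i : ℝ) ≤ l i / (2 * d) := by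
    intro i
    have := hm1 i
    have h0 : (0:ℝ) < m i := by exact_mod_cast hm0 i
    rw [div_le_iff₀ (hl0 i)] at this
    rw [div_le_div_iff₀ h0 (by positivity)]
    linarith
  have hm4 : ∀ i, l i / (2 * d) < l i := fun i => div_lt_self (hl0 i) (by linarith)
  choose p q hp hq hsub hvol using fun i => inner_interval (ha' i) (hb' i) (hab i) (m i) (hm0 i)
    ((hm3 i).trans_lt (hm4 i))
  have hprod : ∏ i, (m i : ℝ) ≤ (5 * d) ^ d / ε := by
    calc ∏ i, (m i : ℝ) ≤ ∏ i, (5 * d / l i) :=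
          Finset.prod_le_prod (fun i _ => by positivity) fun i _ => hm2 i
      _ = (5 * d) ^ d / ∏ i, l i := by
          rw [Finset.prod_div_distrib]; simp
      _ ≤ _ := by gcongr
  refine ⟨fun i => ⟨m i, p i, q i⟩, ?_, hprod, pi_mono fun i _ => hsub i, ?_⟩
  · rw [Fintype.mem_piFinset]
    intro i
    simp only [T, Finset.mem_sigma, Finset.mem_Icc, Finset.mem_product, Finset.mem_range]
    refine ⟨⟨hm0 i, Nat.le_floor (le_trans ?_ hprod)⟩, by have := hp i; omega, by have := hq i; omega⟩
    have : m i ≤ ∏ i, m i := Nat.le_of_dvd (Finset.prod_pos fun i _ => hm0 i)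
      (Finset.dvd_prod_of_mem _ (Finset.mem_univ i))
    exact_mod_cast this
  · unfold bx
    rw [vol_pi]
    have hb : (1:ℝ)/2 ≤ (1 - 1 / (2 * d)) ^ d := by
      have hh : 1 / (2 * (d:ℝ)) ≤ 1 := by
        rw [div_le_one (by positivity)]; linarith
      have := one_add_mul_le_pow (a := - (1 / (2 * (d:ℝ)))) (by linarith) d
      have e : (d:ℝ) * (1 / (2 * d)) = 1/2 := by field_simp
      rw [sub_eq_add_neg]
      linarith
    calc ε / 2 = 1 / 2 * ε := by ring
      _ ≤ (1 - 1 / (2 * d)) ^ d * ∏ i, l i := by gcongr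
      _ = ∏ i, ((1 - 1 / (2 * d)) * l i) := by rw [Finset.prod_mul_distrib]; simp
      _ ≤ _ := by
        refine Finset.prod_le_prod (fun i _ => ?_) fun i _ => ?_
        · have := hm4 i
          have e : (1 - 1 / (2 * (d:ℝ))) * l i = l i - l i / (2 * d) := by ring
          rw [e]; linarith
        · refine le_trans ?_ (hvol i)
          have := hm3 i
          have e : (1 - 1 / (2 * (d:ℝ))) * l i = l i - l i / (2 * d) := by ring
          rw [e]
          change _ ≤ l i - _
          linarith

lemma pdisp_le {d : ℕ} {P : Set (Fin d → ℝ)} {ε : ℝ} (hε : 0 ≤ ε)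
    (h : ∀ B, IsPerBox B → B ∩ P = ∅ → (volume B).toReal ≤ ε) : pdisp P ≤ ε := by
  refine Real.sSup_le ?_ hε
  rintro v ⟨B, hB, hP, rfl⟩
  exact h B hB hP

lemma cube_infinite {d : ℕ} (hd : 1 ≤ d) : (cube d).Infinite := by
  intro h
  have : Nonempty (Fin d) := ⟨⟨0, hd⟩⟩
  have := h.measure_zero volume
  rw [cube_vol] at this
  exact one_ne_zero this

lemma pminDisp_le {d n : ℕ} {ε : ℝ} (hd : 1 ≤ d) (hε : 0 ≤ ε) (P : Finset (Fin d → ℝ))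
    (hP : ↑P ⊆ cube d) (hc : P.card ≤ n)
    (h : ∀ B : Set (Fin d → ℝ), IsPerBox B → B ∩ (P : Set (Fin d → ℝ)) = ∅ → (volume B).toReal ≤ ε) :
    pminDisp n d ≤ ε := by
  obtain ⟨Q, hQ, hQc, hQn⟩ : ∃ Q : Finset (Fin d → ℝ), P ⊆ Q ∧ ↑Q ⊆ cube d ∧ Q.card = n := by
    classical
    obtain ⟨R, hR, hRc⟩ := ((cube_infinite hd).sdiff P.finite_toSet).exists_subset_card_eq
      (n - P.card)
    refine ⟨P ∪ R, Finset.subset_union_left, ?_, ?_⟩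
    · rw [Finset.coe_union]
      exact union_subset hP fun x hx => (hR hx).1
    · rw [Finset.card_union_of_disjoint, hRc]
      · omega
      · rw [Finset.disjoint_left]
        exact fun x hx hxR => (hR hxR).2 hx
  refine le_trans (b := pdisp (Q : Set (Fin d → ℝ))) (csInf_le ⟨0, ?_⟩ ⟨Q, hQc, hQn, rfl⟩)
    (pdisp_le hε fun B hB hBQ => h B hB ?_)
  · rintro v ⟨P, -, -, rfl⟩
    refine Real.sSup_nonneg ?_
    rintro v ⟨B, -, -, rfl⟩
    exact ENNReal.toReal_nonneg
  · exact subset_empty_iff.1 (hBQ ▸ inter_subset_inter_right _ (by exact_mod_cast hQ))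

open Classical in
lemma key {d n : ℕ} {ε : ℝ} (hd : 1 ≤ d) (hε : 0 < ε) (hε1 : ε ≤ 1)
    (h : (1 - ε / 2) ^ n * (((5 * d) ^ d / ε) ^ 4 * 8 ^ d) < 1) : pminDisp n d ≤ ε := by
  set F := ((Fintype.piFinset fun _ : Fin d => T ⌊(5 * d) ^ d / ε⌋₊).filter
      fun f => ∏ i, ((f i).1 : ℝ) ≤ (5 * d) ^ d / ε) with hF
  set F' := F.filter fun f => ε / 2 ≤ (volume (bx f)).toReal with hF'
  have hcard : (F'.card : ℝ) ≤ ((5 * d) ^ d / ε) ^ 4 * 8 ^ d :=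
    (Nat.cast_le.2 (Finset.card_filter_le F _)).trans (count d _ _ (by positivity))
  obtain ⟨P, hP, hPn, hPc⟩ := greedy F' bx (ε / 2) (by linarith)
    (fun f _ => MeasurableSet.univ_pi fun i => perInterval_measurable _ _)
    (fun f hf => by
      refine pi_mono fun i _ => ?_
      have h1 := Fintype.mem_piFinset.1 (Finset.mem_filter.1 (Finset.mem_filter.1 hf).1).1 i
      simp only [T, Finset.mem_sigma, Finset.mem_Icc, Finset.mem_product, Finset.mem_range] at h1
      obtain ⟨⟨h1, -⟩, h2, h3⟩ := h1
      have h4 : (0:ℝ) < (f i).1 := by exact_mod_cast h1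
      refine perInterval_subset_Icc ⟨by positivity, ?_⟩ ⟨by positivity, ?_⟩
      · rw [div_le_one h4]; exact_mod_cast Nat.lt_succ_iff.1 h2
      · rw [div_le_one h4]; exact_mod_cast Nat.lt_succ_iff.1 h3)
    (fun f hf => (Finset.mem_filter.1 hf).2) n
  have h0 : (F'.filter fun f => ∀ x ∈ P, x ∉ bx f).card = 0 := by
    have : ((F'.filter fun f => ∀ x ∈ P, x ∉ bx f).card : ℝ) < 1 := by
      refine hPc.trans_lt (lt_of_le_of_lt ?_ h)
      exact mul_le_mul_of_nonneg_left hcard (pow_nonneg (by linarith) _)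
    exact Nat.lt_one_iff.1 (by exact_mod_cast this)
  refine pminDisp_le hd hε.le P hP hPn fun B hB hBP => ?_
  by_contra! hlt
  obtain ⟨f, hf1, hf2, hf3, hf4⟩ := inner_box hd hB hε hlt
  have : f ∈ (F'.filter fun f => ∀ x ∈ P, x ∉ bx f) := by
    simp only [hF', hF, Finset.mem_filter]
    refine ⟨⟨⟨hf1, hf2⟩, hf4⟩, fun x hx hxf => ?_⟩
    have : x ∈ B ∩ (P : Set (Fin d → ℝ)) := ⟨hf3 hxf, hx⟩
    rw [hBP] at this
    exact this
  rw [Finset.card_eq_zero.1 h0] at this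
  simp at this

/-- There exists an absolute constant `C ≥ 1` such that for every integer `d ≥ 2` and every
integer `n` with `2 d ln d ≤ n ≤ e^d · d · ln d`, one has `disp̃*(n,d) ≤ C d ln d / n`. -/
theorem periodic_minimal_dispersion_bound_medium_n :
    ∃ C : ℝ, 1 ≤ C ∧ ∀ d : ℕ, 2 ≤ d → ∀ n : ℕ,
      2 * d * Real.log d ≤ (n : ℝ) →
      (n : ℝ) ≤ Real.exp d * d * Real.log d →
      pminDisp n d ≤ C * d * Real.log d / n := by
  refine ⟨100, by norm_num, fun d hd n hn1 hn2 => ?_⟩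
  have hd' : (2:ℝ) ≤ d := by exact_mod_cast hd
  have hL : 1 / 2 < Real.log d := by
    have := Real.log_le_log (by norm_num) hd'
    have := Real.log_two_gt_d9
    linarith
  set L := Real.log d with hLdef
  have hdL : 0 < d * L := by positivity
  have hn : (0:ℝ) < n := by nlinarith
  set ε := 100 * d * L / n with hεdef
  have hε : 0 < ε := by positivity
  rcases le_total 1 ε with h1 | h1
  · refine pminDisp_le (by omega) hε.le ∅ (by simp) (by simp) fun B hB _ => le_trans ?_ h1
    obtain ⟨a, b, ha, hb, -, rfl⟩ := hB
    rw [vol_pi]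
    exact Finset.prod_le_one (fun _ _ => ENNReal.toReal_nonneg)
      fun i _ => vol_le_one (ha i (mem_univ i)) (hb i (mem_univ i))
  · refine key (by omega) hε h1 ?_
    have hεe : Real.exp (-d) ≤ ε := by
      rw [hεdef, le_div_iff₀ hn, Real.exp_neg, inv_mul_le_iff₀ (Real.exp_pos _)]
      have := Real.exp_pos (d:ℝ)
      nlinarith [mul_pos this hdL]
    have hA : (1 - ε / 2) ^ n ≤ Real.exp (-(50 * d * L)) := by
      calc (1 - ε / 2) ^ n ≤ (Real.exp (-(ε/2))) ^ n :=
            pow_le_pow_left₀ (by linarith) (by linarith [Real.add_one_le_exp (-(ε/2))]) n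
        _ = Real.exp (n * (-(ε/2))) := (Real.exp_nat_mul _ _).symm
        _ = _ := by
            congr 1
            rw [hεdef]; field_simp; ring
    have he := Real.exp_one_gt_d9
    have h5 : (5 * d : ℝ) ≤ Real.exp (2 + L) := by
      rw [Real.exp_add, hLdef, Real.exp_log (by linarith)]
      have : (5:ℝ) ≤ Real.exp 2 := by
        have e : Real.exp 2 = Real.exp 1 * Real.exp 1 := by rw [← Real.exp_add]; norm_num
        rw [e]; nlinarith
      gcongr
    have h8 : (8:ℝ) ≤ Real.exp 3 := by
      have e : Real.exp 3 = Real.exp 1 ^ 3 := by rw [← Real.exp_nat_mul]; norm_num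
      rw [e]
      calc (8:ℝ) = 2 ^ 3 := by norm_num
        _ ≤ _ := by gcongr; linarith
    have hB : ((5 * d) ^ d / ε) ^ 4 * 8 ^ d ≤ Real.exp (15 * d + 4 * d * L) := by
      calc ((5 * d) ^ d / ε) ^ 4 * (8:ℝ) ^ d
          ≤ ((Real.exp (2 + L)) ^ d / Real.exp (-d)) ^ 4 * (Real.exp 3) ^ d := by gcongr
        _ = _ := by
          rw [← Real.exp_nat_mul, ← Real.exp_nat_mul, ← Real.exp_sub, ← Real.exp_nat_mul,
            ← Real.exp_add]
          congr 1
          push_cast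
          ring
    calc _ ≤ Real.exp (-(50 * d * L)) * Real.exp (15 * d + 4 * d * L) := by gcongr
      _ = Real.exp (-(50 * d * L) + (15 * d + 4 * d * L)) := (Real.exp_add _ _).symm
      _ < 1 := by
        rw [Real.exp_lt_one_iff]
        nlinarith
end
end

section
/- There exists an absolute constant C ≥ 1 such that for every integer d ≥ 4 and every ε ∈ (0, 1/4] with d ≥ 4 ln(1/ε), the family B_{ε,d} admits a (3/4)-net of cardinality at most exp(C · d · ln ln(1/ε)). -/
open MeasureTheory Set

noncomputable section

/-- `B` is an axis-parallel box `∏ [aᵢ, bᵢ)` contained in the unit cube. -/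
def IsBox {d : ℕ} (B : Set (Fin d → ℝ)) : Prop :=
  ∃ a b : Fin d → ℝ, (∀ i, 0 ≤ a i ∧ a i ≤ b i ∧ b i ≤ 1) ∧
    B = Set.univ.pi fun i => Set.Ico (a i) (b i)

/-- `F` is a `δ`-net for the family `B_{ε,d}` of boxes of volume at least `ε`. -/
def IsDeltaNet (δ ε : ℝ) (d : ℕ) (F : Finset (Set (Fin d → ℝ))) : Prop :=
  (∀ B ∈ F, IsBox B) ∧
  ∀ B : Set (Fin d → ℝ), IsBox B → ε ≤ (volume B).toReal →
    ∃ B₀ ∈ F, B₀ ⊆ B ∧ (1 - δ) * (volume B).toReal ≤ (volume B₀).toReal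

lemma net_geom (X : ℝ) (hX : 1 ≤ X) (N : ℕ) :
    ∑ k ∈ Finset.range N, Real.exp (-(k / X)) ≤ 2 * X := by
  have h1 : Real.exp (-(1 / X)) ≤ X / (X + 1) := by
    rw [Real.exp_neg]
    have := Real.add_one_le_exp (1 / X)
    have h2 : 1 / X + 1 = (X + 1) / X := by field_simp; ring
    rw [h2] at this
    calc _ ≤ ((X+1)/X)⁻¹ := by gcongr
      _ = _ := by rw [inv_div]
  have h0 : (0:ℝ) < X / (X+1) := by positivity
  calc ∑ k ∈ Finset.range N, Real.exp (-(k / X)) ≤ ∑ k ∈ Finset.range N, (X / (X+1))^k := by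
        apply Finset.sum_le_sum
        intro k _
        have : -((k:ℝ)/X) = k * (-(1/X)) := by ring
        rw [this, Real.exp_nat_mul]
        gcongr
    _ ≤ X + 1 := by
        have := geom_sum_mul_neg (X / (X+1)) N
        have h3 : 1 - X/(X+1) = 1/(X+1) := by field_simp; ring
        rw [h3] at this
        have h4 : 0 ≤ (X / (X+1))^N := by positivity
        have h5 : (∑ k ∈ Finset.range N, (X / (X+1))^k) = (1 - (X / (X+1))^N) * (X+1) := by
          rw [← this]; field_simp
        rw [h5]; nlinarith
    _ ≤ 2 * X := by linarith

/-- cost of a label -/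
def netCost (L : ℝ) (p : ℕ × ℕ × ℕ) : ℝ :=
  p.1 * Real.log 8 + (p.2.1 + p.2.2 : ℝ) / (2 ^ p.1 * L * 16)

lemma net_sum (L : ℝ) (hL : 1 ≤ L) (M N : ℕ) :
    ∑ p ∈ Finset.range M ×ˢ Finset.range N ×ˢ Finset.range N, Real.exp (- netCost L p) ≤ 2048 * L ^ 2 := by
  rw [Finset.sum_product]
  calc _ ≤ ∑ m ∈ Finset.range M, (1024 * L^2) * (1/2:ℝ)^m := by
        apply Finset.sum_le_sum
        intro m _
        rw [Finset.sum_product]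
        have hX : 1 ≤ (2:ℝ)^m * L * 16 := by
          have : (1:ℝ) ≤ 2^m := one_le_pow₀ (by norm_num)
          nlinarith
        have hg := net_geom _ hX N
        have hg0 : 0 ≤ ∑ k ∈ Finset.range N, Real.exp (-(k / ((2:ℝ)^m * L * 16))) :=
          Finset.sum_nonneg fun _ _ => (Real.exp_pos _).le
        have e : ∑ x ∈ Finset.range N, ∑ y ∈ Finset.range N, Real.exp (-netCost L (m, x, y))
            = (1/8:ℝ)^m * ((∑ k ∈ Finset.range N, Real.exp (-(k / ((2:ℝ)^m * L * 16)))) *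
               (∑ k ∈ Finset.range N, Real.exp (-(k / ((2:ℝ)^m * L * 16))))) := by
          rw [Finset.sum_mul_sum, Finset.mul_sum]
          refine Finset.sum_congr rfl fun x _ => ?_
          rw [Finset.mul_sum]
          refine Finset.sum_congr rfl fun y _ => ?_
          rw [← Real.exp_add]
          have : (1/8:ℝ)^m = Real.exp (-(m * Real.log 8)) := by
            rw [Real.exp_neg, Real.exp_nat_mul, Real.exp_log (by norm_num)]; simp
          rw [this, ← Real.exp_add]
          congr 1
          simp only [netCost]
          ring
        rw [e]
        calc _ ≤ (1/8:ℝ)^m * ((2 * ((2:ℝ)^m * L * 16)) * (2 * ((2:ℝ)^m * L * 16))) := by gcongr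
          _ = (1024 * L^2) * ((1/8:ℝ)^m * 2^m * 2^m) := by ring
          _ = _ := by rw [← mul_pow, ← mul_pow]; norm_num
    _ ≤ (1024 * L^2) * 2 := by
        rw [← Finset.mul_sum]
        gcongr
        exact sum_geometric_two_le M
    _ = _ := by ring

lemma net_count (d : ℕ) (L T : ℝ) (hL : 1 ≤ L) (M N : ℕ) :
    ((((Fintype.piFinset fun _ : Fin d => Finset.range M ×ˢ Finset.range N ×ˢ Finset.range N).filter
      fun x => ∑ i, netCost L (x i) ≤ T).card : ℕ) : ℝ) ≤ Real.exp T * (2048 * L ^ 2) ^ d := by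
  set P := Finset.range M ×ˢ Finset.range N ×ˢ Finset.range N
  calc _ = ∑ x ∈ (Fintype.piFinset fun _ : Fin d => P).filter
        (fun x => ∑ i, netCost L (x i) ≤ T), (1:ℝ) := by simp
    _ ≤ ∑ x ∈ (Fintype.piFinset fun _ : Fin d => P).filter
        (fun x => ∑ i, netCost L (x i) ≤ T), Real.exp T * ∏ i, Real.exp (- netCost L (x i)) := by
        apply Finset.sum_le_sum
        intro x hx
        rw [Finset.mem_filter] at hx
        rw [← Real.exp_sum, ← Real.exp_add]
        apply Real.one_le_exp
        rw [Finset.sum_neg_distrib]; linarith [hx.2]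
    _ ≤ ∑ x ∈ (Fintype.piFinset fun _ : Fin d => P),
         Real.exp T * ∏ i, Real.exp (- netCost L (x i)) := by
        apply Finset.sum_le_sum_of_subset_of_nonneg (Finset.filter_subset _ _)
        intros; positivity
    _ = Real.exp T * (∑ p ∈ P, Real.exp (- netCost L p)) ^ d := by
        rw [← Finset.mul_sum, Finset.sum_prod_piFinset P (fun _ p => Real.exp (- netCost L p))]
        simp
    _ ≤ _ := by
        gcongr
        exact net_sum L hL M N

/-- grid step -/
def netStep (D L : ℝ) (m : ℕ) : ℝ :=
  if m = 0 then 1 / (16 * D) else 1 / (16 * 2 ^ m * L)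

lemma net_coord (D L a b : ℝ) (hD : 1 ≤ D) (hL : 1 ≤ L) (ha : 0 ≤ a) (hb : b ≤ 1)
    (hab : a < b) : ∃ m k k' : ℕ, b - a ≤ (1/2:ℝ)^m ∧ a ≤ k * netStep D L m ∧
      1 - k' * netStep D L m ≤ b ∧
      (b - a) * (1 - 1/4 * (1 / D + m / L)) ≤ (1 - k' * netStep D L m) - k * netStep D L m ∧
      (k + k' : ℝ) / (2 ^ m * L * 16) ≤ (1 - (b - a)) * D / L + 3 := by
  obtain ⟨m, hm1, hm2⟩ := exists_nat_pow_near_of_lt_one (x := b - a) (y := (1/2:ℝ))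
    (by linarith) (by linarith) (by norm_num) (by norm_num)
  have hs : 0 < netStep D L m := by
    unfold netStep; split_ifs <;> positivity
  set s := netStep D L m with hsdef
  have k1 := Nat.le_ceil (a / s)
  have k2 := Nat.ceil_lt_add_one (a := a / s) (by positivity)
  have hb0 : 0 ≤ 1 - b := by linarith
  have k3 := Nat.le_ceil ((1 - b) / s)
  have k4 := Nat.ceil_lt_add_one (a := (1 - b) / s) (by positivity)
  generalize Nat.ceil (a / s) = k at *
  generalize Nat.ceil ((1 - b) / s) = k' at *
  rw [div_le_iff₀ hs] at k1 k3
  have k2' : (k:ℝ) * s < a + s := by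
    have := mul_lt_mul_of_pos_right k2 hs
    rwa [add_mul, div_mul_cancel₀ _ hs.ne', one_mul] at this
  have k4' : (k':ℝ) * s < (1 - b) + s := by
    have := mul_lt_mul_of_pos_right k4 hs
    rwa [add_mul, div_mul_cancel₀ _ hs.ne', one_mul] at this
  have hp : (1:ℝ) ≤ 2^m := one_le_pow₀ (by norm_num)
  have hY : 1 ≤ (2:ℝ)^m * L * 16 := by nlinarith
  refine ⟨m, k, k', hm2, k1, by linarith, ?_, ?_⟩
  · have key : 2 * s ≤ (b - a) * (1/4 * (1 / D + m / L)) := by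
      rw [hsdef]; unfold netStep
      split_ifs with h0
      · subst h0
        have : 2 * (1 / (16 * D)) = (1/2) * (1/4 * (1/D)) := by field_simp; norm_num
        rw [this]
        simp at hm1 ⊢
        gcongr
      · have h1m : (1:ℝ) ≤ m := by exact_mod_cast Nat.one_le_iff_ne_zero.2 h0
        have : 2 * (1 / (16 * 2^m * L)) = (1/2:ℝ)^(m+1) * (1/4 * (0 + 1/L)) := by
          rw [pow_succ, one_div_pow]; field_simp; norm_num
        rw [this]
        gcongr
        positivity
    nlinarith
  · have hkk : (k + k' : ℝ) ≤ (1 - (b - a)) / s + 2 := by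
      have : (1 - (b - a)) / s = a / s + (1 - b) / s := by ring
      linarith
    have hl : 0 ≤ 1 - (b - a) := by linarith
    have h2 : 2 / ((2:ℝ)^m * L * 16) ≤ 2 := by
      rw [div_le_iff₀ (by linarith)]; linarith
    have h3 : (1 - (b - a)) / s / (2^m * L * 16) ≤ (1 - (b - a)) * D / L + 1 := by
      have hq : 0 ≤ (1 - (b - a)) * D / L := by positivity
      rw [hsdef]; unfold netStep
      split_ifs with h0
      · subst h0
        have : (1 - (b - a)) / (1 / (16 * D)) / (2^0 * L * 16) = (1 - (b - a)) * D / L := by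
          field_simp
        linarith
      · have : (1 - (b - a)) / (1 / (16 * 2^m * L)) / (2^m * L * 16) = (1 - (b - a)) := by
          field_simp
        linarith
    calc _ ≤ ((1 - (b - a)) / s + 2) / (2 ^ m * L * 16) := by gcongr
      _ ≤ _ := by rw [add_div]; linarith

lemma net_prod {ι : Type*} (s : Finset ι) (x : ι → ℝ) (h0 : ∀ i, 0 ≤ x i) (h1 : ∀ i, x i ≤ 1) :
    1 - ∑ i ∈ s, x i ≤ ∏ i ∈ s, (1 - x i) ∧ ∏ i ∈ s, (1 - x i) ≤ 1 := by
  classical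
  induction s using Finset.induction_on with
  | empty => simp
  | insert a s ha ih =>
    rw [Finset.sum_insert ha, Finset.prod_insert ha]
    have hn : 0 ≤ ∏ i ∈ s, (1 - x i) := Finset.prod_nonneg fun i _ => by linarith [h1 i]
    constructor <;> nlinarith [h0 a, h1 a, ih.1, ih.2]

/-- box attached to a tuple of labels -/
def netBox (d : ℕ) (L : ℝ) (x : Fin d → ℕ × ℕ × ℕ) : Set (Fin d → ℝ) :=
  Set.univ.pi fun i => Set.Ico ((x i).2.1 * netStep d L (x i).1)
    (1 - (x i).2.2 * netStep d L (x i).1)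

lemma net_main (d : ℕ) (hd : 4 ≤ d) (L : ℝ) (hL : 1 ≤ L) (hdL : 4 * L ≤ d)
    (B : Set (Fin d → ℝ)) (hB : IsBox B) (hv : Real.exp (-L) ≤ (volume B).toReal) :
    ∃ x : Fin d → ℕ × ℕ × ℕ, ∑ i, netCost L (x i) ≤ 5 * d ∧ IsBox (netBox d L x) ∧
      netBox d L x ⊆ B ∧ (1 - 3/4) * (volume B).toReal ≤ (volume (netBox d L x)).toReal := by
  obtain ⟨a, b, hab, rfl⟩ := hB
  rw [Real.volume_pi_Ico_toReal (fun i => (hab i).2.1)] at hv ⊢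
  have hpos : 0 < ∏ i, (b i - a i) := lt_of_lt_of_le (Real.exp_pos _) hv
  have hl : ∀ i, 0 < b i - a i := by
    intro i
    rcases (sub_nonneg.2 (hab i).2.1).lt_or_eq with h | h
    · exact h
    · rw [Finset.prod_eq_zero (Finset.mem_univ i) h.symm] at hpos
      exact absurd hpos (lt_irrefl _)
  have hlog : -L ≤ ∑ i, Real.log (b i - a i) := by
    rw [← Real.log_prod (fun i _ => (hl i).ne')]
    exact (Real.le_log_iff_exp_le hpos).2 hv
  have hD : (4:ℝ) ≤ d := by exact_mod_cast hd
  have hL0 : 0 < L := by linarith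
  choose m k k' h1 h2 h3 h4 h5 using fun i => net_coord d L (a i) (b i) (by linarith) hL
    (hab i).1 (hab i).2.2 (sub_pos.1 (hl i))
  have hm : (∑ i, (m i : ℝ)) * Real.log 2 ≤ L := by
    have : ∀ i, (m i : ℝ) * Real.log 2 ≤ - Real.log (b i - a i) := by
      intro i
      have := Real.log_le_log (hl i) (h1 i)
      rw [Real.log_pow, one_div, Real.log_inv] at this
      linarith
    rw [Finset.sum_mul]
    calc _ ≤ ∑ i, - Real.log (b i - a i) := Finset.sum_le_sum fun i _ => this i
      _ ≤ L := by rw [Finset.sum_neg_distrib]; linarith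
  have hone : ∑ i, (1 - (b i - a i)) ≤ L := by
    calc _ ≤ ∑ i, - Real.log (b i - a i) := Finset.sum_le_sum fun i _ => by
          have := Real.log_le_sub_one_of_pos (hl i); linarith
      _ ≤ L := by rw [Finset.sum_neg_distrib]; linarith
  have hlog2 := Real.log_two_gt_d9
  have hm0 : 0 ≤ ∑ i, (m i : ℝ) := Finset.sum_nonneg fun _ _ => by positivity
  have hm2 : ∑ i, (m i : ℝ) ≤ 2 * L := by nlinarith
  set ξ : Fin d → ℝ := fun i => 1/4 * (1 / d + m i / L) with hξ
  have hξ0 : ∀ i, 0 ≤ ξ i := fun i => by simp only [hξ]; positivity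
  have hξs : ∑ i, ξ i ≤ 3/4 := by
    simp only [hξ]
    rw [← Finset.mul_sum, Finset.sum_add_distrib]
    have e1 : ∑ i : Fin d, (1 / (d:ℝ)) = 1 := by
      simp; field_simp
    have e2 : (∑ i, (m i : ℝ)) / L ≤ 2 := by rwa [div_le_iff₀ hL0]
    rw [e1, ← Finset.sum_div]; linarith
  have hξ1 : ∀ i, ξ i ≤ 1 := fun i => by
    have := Finset.single_le_sum (f := ξ) (fun i _ => hξ0 i) (Finset.mem_univ i)
    linarith
  have hle : ∀ i, (k i : ℝ) * netStep d L (m i) ≤ 1 - k' i * netStep d L (m i) := fun i => by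
    have := h4 i
    have h6 : 0 ≤ (b i - a i) * (1 - ξ i) := mul_nonneg (hl i).le (by linarith [hξ1 i])
    simp only [hξ] at h6
    linarith
  refine ⟨fun i => (m i, k i, k' i), ?_, ?_, ?_, ?_⟩
  · simp only [netCost]
    rw [Finset.sum_add_distrib, ← Finset.sum_mul]
    have e8 : Real.log 8 = 3 * Real.log 2 := by
      rw [show (8:ℝ) = 2^3 by norm_num, Real.log_pow]; norm_num
    have e5 : ∑ i, (k i + k' i : ℝ) / (2 ^ (m i) * L * 16) ≤ 4 * d := by
      calc _ ≤ ∑ i, ((1 - (b i - a i)) * d / L + 3) := Finset.sum_le_sum fun i _ => h5 i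
        _ = (∑ i, (1 - (b i - a i))) * (d / L) + 3 * d := by
            rw [Finset.sum_add_distrib, Finset.sum_mul]
            congr 1
            · exact Finset.sum_congr rfl fun i _ => by ring
            · simp; ring
        _ ≤ L * (d / L) + 3 * d := by gcongr
        _ = 4 * d := by field_simp; ring
    rw [e8]; linarith
  · exact ⟨_, _, fun i => ⟨(hab i).1.trans (h2 i), hle i, (h3 i).trans (hab i).2.2⟩, rfl⟩
  · exact Set.pi_mono fun i _ => Set.Ico_subset_Ico (h2 i) (h3 i)
  · unfold netBox
    rw [Real.volume_pi_Ico_toReal hle]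
    calc (1 - 3/4) * ∏ i, (b i - a i) ≤ (∏ i, (1 - ξ i)) * ∏ i, (b i - a i) := by
          gcongr
          linarith [(net_prod Finset.univ ξ hξ0 hξ1).1]
      _ = ∏ i, ((b i - a i) * (1 - ξ i)) := by rw [← Finset.prod_mul_distrib]; simp only [mul_comm]
      _ ≤ _ := Finset.prod_le_prod
          (fun i _ => mul_nonneg (hl i).le (by linarith [hξ1 i])) (fun i _ => h4 i)

lemma net_cost_bound (L T : ℝ) (hL : 1 ≤ L) : ∃ M N : ℕ, ∀ p, netCost L p ≤ T →
    p ∈ Finset.range M ×ˢ Finset.range N ×ˢ Finset.range N := by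
  obtain ⟨M, hM⟩ := exists_nat_gt T
  obtain ⟨N, hN⟩ := exists_nat_gt (T * (2 ^ M * L * 16))
  refine ⟨M, N, fun p hp => ?_⟩
  unfold netCost at hp
  have h8 : (1:ℝ) ≤ Real.log 8 := by
    have e8 : Real.log 8 = 3 * Real.log 2 := by
      rw [show (8:ℝ) = 2^3 by norm_num, Real.log_pow]; norm_num
    linarith [Real.log_two_gt_d9]
  have q : 0 ≤ (p.2.1 + p.2.2 : ℝ) / (2 ^ p.1 * L * 16) := by positivity
  have q' : 0 ≤ (p.1:ℝ) := by positivity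
  have hm : p.1 < M := by
    have : (p.1:ℝ) < M := by nlinarith
    exact_mod_cast this
  have hk : (p.2.1 + p.2.2 : ℝ) < N := by
    have h1 : (p.2.1 + p.2.2 : ℝ) / (2 ^ p.1 * L * 16) ≤ T := by nlinarith
    rw [div_le_iff₀ (by positivity)] at h1
    have hT : 0 ≤ T := by nlinarith
    have : T * (2 ^ p.1 * L * 16) ≤ T * (2 ^ M * L * 16) := by
      gcongr
      norm_num
    linarith
  have hk' : p.2.1 + p.2.2 < N := by exact_mod_cast hk
  simp only [Finset.mem_product, Finset.mem_range]
  omega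

/-- There exists an absolute constant `C ≥ 1` such that for every integer `d ≥ 4` and every
`ε ∈ (0, 1/4]` with `d ≥ 4 ln(1/ε)`, the family `B_{ε,d}` admits a `(3/4)`-net of
cardinality at most `exp(C d ln ln(1/ε))`. -/
theorem exists_three_quarters_net :
    ∃ C : ℝ, 1 ≤ C ∧ ∀ d : ℕ, 4 ≤ d → ∀ ε : ℝ, 0 < ε → ε ≤ 1 / 4 →
      4 * Real.log (1 / ε) ≤ (d : ℝ) →
      ∃ F : Finset (Set (Fin d → ℝ)), IsDeltaNet (3 / 4) ε d F ∧
        (F.card : ℝ) ≤ Real.exp (C * d * Real.log (Real.log (1 / ε))) := by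
  classical
  refine ⟨100, by norm_num, fun d hd ε hε hε4 hdL => ?_⟩
  set L := Real.log (1 / ε) with hLdef
  have hlog2 := Real.log_two_gt_d9
  have hL : 1.38 ≤ L := by
    have h4 : Real.log 4 ≤ L := by
      apply Real.log_le_log (by norm_num)
      rw [le_div_iff₀ hε]; linarith
    rw [show (4:ℝ) = 2^2 by norm_num, Real.log_pow] at h4
    push_cast at h4
    linarith
  have hL1 : 1 ≤ L := by linarith
  have hexp : Real.exp (-L) = ε := by
    rw [hLdef, one_div, Real.log_inv, neg_neg, Real.exp_log hε]
  obtain ⟨M, N, hMN⟩ := net_cost_bound L (5 * d) hL1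
  set S := (Fintype.piFinset fun _ : Fin d =>
      Finset.range M ×ˢ Finset.range N ×ˢ Finset.range N).filter
      fun x => ∑ i, netCost L (x i) ≤ 5 * d with hS
  refine ⟨(S.image (netBox d L)).filter IsBox, ⟨fun B hB => (Finset.mem_filter.1 hB).2, ?_⟩, ?_⟩
  · intro B hB hv
    obtain ⟨x, hx1, hx2, hx3, hx4⟩ := net_main d hd L hL1 hdL B hB (hexp.symm ▸ hv)
    refine ⟨netBox d L x, ?_, hx3, hx4⟩
    rw [Finset.mem_filter]
    refine ⟨Finset.mem_image_of_mem _ ?_, hx2⟩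
    rw [hS, Finset.mem_filter]
    refine ⟨?_, hx1⟩
    rw [Fintype.mem_piFinset]
    intro i
    apply hMN
    refine le_trans (Finset.single_le_sum (f := fun i => netCost L (x i)) (fun i _ => ?_)
      (Finset.mem_univ i)) hx1
    have : 0 ≤ Real.log 8 := Real.log_nonneg (by norm_num)
    unfold netCost
    positivity
  · have hcard : ((((S.image (netBox d L)).filter IsBox).card : ℕ) : ℝ) ≤ S.card := by
      exact_mod_cast (Finset.card_filter_le _ _).trans Finset.card_image_le
    refine hcard.trans ((net_count d L (5 * d) hL1 M N).trans ?_)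
    have hLp : 0 < L := by linarith
    have e : 2048 * L ^ 2 = Real.exp (11 * Real.log 2 + 2 * Real.log L) := by
      rw [Real.exp_add, mul_comm 11, mul_comm 2, Real.exp_mul, Real.exp_mul,
        Real.exp_log (by norm_num), Real.exp_log hLp]
      norm_cast
    rw [e, ← Real.exp_nat_mul, ← Real.exp_add]
    apply Real.exp_le_exp.2
    have hll : 1/4 ≤ Real.log L := by
      have h1 := Real.one_sub_inv_le_log_of_pos hLp
      have h2 : L⁻¹ ≤ (1.38:ℝ)⁻¹ := by gcongr
      norm_num at h1 h2
      linarith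
    have hl2 := Real.log_two_lt_d9
    have hd0 : (0:ℝ) ≤ d := by positivity
    nlinarith
end
end
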